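/- Let t ≥ 2 be an integer and let G be a graph containing no copy of K_{2,t} (the complete bipartite graph with parts of sizes 2 and t). Let H be the 4-uniform hypergraph whose edges are the 4-element vertex sets {a, b, c, d} such that ab and cd are edges of G while ac, ad, bc, bd are not edges of G. Then H contains no copy of K_{2,t}^{(4)}. -/

import Mathlib

/-- The 4-uniform hypergraph associated to a graph `G`: its edges are the 4-element
vertex sets `{a, b, c, d}` such that `ab` and `cd` are edges of `G` while `ac`, `ad`,
`bc`, `bd` are not (vertex sets of induced 2-matchings of `G`). -/
def induced2MatchingHypergraph {V : Type*} [DecidableEq V] (G : SimpleGraph V) :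
    Set (Finset V) :=
  {s | ∃ a b c d : V, s = {a, b, c, d} ∧ s.card = 4 ∧
    G.Adj a b ∧ G.Adj c d ∧
    ¬ G.Adj a c ∧ ¬ G.Adj a d ∧ ¬ G.Adj b c ∧ ¬ G.Adj b d}

/-- A graph `G` contains a copy of `K_{2,t}`: there are distinct vertices `u, v` and
`t` further distinct vertices `w_1, …, w_t` (all different from `u, v`), each adjacent
to both `u` and `v`. -/
def graphHasK2t {V : Type*} [DecidableEq V] (t : ℕ) (G : SimpleGraph V) : Prop :=
  ∃ (u v : V) (w : Fin t → V),
    ({u, v} ∪ Finset.image w Finset.univ).card = t + 2 ∧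
    ∀ i : Fin t, G.Adj u (w i) ∧ G.Adj v (w i)

/-- A 4-uniform hypergraph `H` (here a set of 4-element `Finset`s) contains a copy of
`K_{2,t}^{(4)}`: there are distinct vertices `a, b, x_1, …, x_t, y_1, …, y_t,
z_1, …, z_t` (i.e. `3t+2` distinct vertices) such that all quadruples
`{a, x i, y i, z i}` and `{b, x i, y i, z i}` are edges of `H`. -/
def hasK2t4 {V : Type*} [DecidableEq V] (t : ℕ) (H : Set (Finset V)) : Prop :=
  ∃ (a b : V) (x y z : Fin t → V),
    ({a, b} ∪ Finset.image x Finset.univ ∪ Finset.image y Finset.univ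
      ∪ Finset.image z Finset.univ).card = 3 * t + 2 ∧
    ∀ i : Fin t,
      ({a, x i, y i, z i} : Finset V) ∈ H ∧ ({b, x i, y i, z i} : Finset V) ∈ H

theorem aux_edge {V : Type*} [DecidableEq V] (G : SimpleGraph V) (a x y z : V)
    (hx : a ≠ x) (hy : a ≠ y) (hz : a ≠ z)
    (h : ({a, x, y, z} : Finset V) ∈ induced2MatchingHypergraph G) :
    ∃ w, (w = x ∨ w = y ∨ w = z) ∧ G.Adj a w ∧
      (∀ u, (u = x ∨ u = y ∨ u = z) → ¬ G.Adj w u) ∧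
      (∀ u, (u = x ∨ u = y ∨ u = z) → u ≠ w →
        ∃ v, (v = x ∨ v = y ∨ v = z) ∧ G.Adj u v) := by
  obtain ⟨p, q, r, s, he, -, h1, h2, h3, h4, h5, h6⟩ := h
  have hm : ∀ u, (u = a ∨ (u = x ∨ u = y ∨ u = z)) ↔ (u = p ∨ u = q ∨ u = r ∨ u = s) := by
    intro u
    have := congrArg (fun S => u ∈ S) he
    simpa using this
  have hna : ¬ (a = x ∨ a = y ∨ a = z) := by tauto
  generalize hT : (fun u => u = x ∨ u = y ∨ u = z) = T
  have hT' : ∀ u, (u = x ∨ u = y ∨ u = z) ↔ T u := fun u => by rw [← hT]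
  simp only [hT'] at *
  clear hT hT' he hx hy hz
  have h1' := h1.symm
  have h2' := h2.symm
  have h3' : ¬ G.Adj r p := fun h => h3 h.symm
  have h4' : ¬ G.Adj s p := fun h => h4 h.symm
  have h5' : ¬ G.Adj r q := fun h => h5 h.symm
  have h6' : ¬ G.Adj s q := fun h => h6 h.symm
  have hirr : ∀ u, ¬ G.Adj u u := fun u => G.irrefl
  have key : ∀ p q r s : V, G.Adj p q → G.Adj q p → G.Adj r s → G.Adj s r →
      ¬ G.Adj q r → ¬ G.Adj q s → ¬ G.Adj p r → ¬ G.Adj p s →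
      (∀ u, (u = a ∨ T u) ↔ (u = p ∨ u = q ∨ u = r ∨ u = s)) → a = p →
      ∃ w, T w ∧ G.Adj a w ∧ (∀ u, T u → ¬ G.Adj w u) ∧
        (∀ u, T u → u ≠ w → ∃ v, T v ∧ G.Adj u v) := by
    intro p q r s k1 k1' k2 k2' k3 k4 k5 k6 hm hap
    subst hap
    have e : ∀ u, u ≠ a → (u = q ∨ u = r ∨ u = s) → T u := by
      intro u hu h
      have := (hm u).2 (Or.inr h)
      tauto
    have hq : T q := e q (by rintro rfl; exact hirr _ k1) (by tauto)
    have hr : T r := e r (by rintro rfl; exact k3 k1') (by tauto)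
    have hs : T s := e s (by rintro rfl; exact k4 k1') (by tauto)
    refine ⟨q, hq, k1, ?_, ?_⟩
    · intro u hu
      rcases (hm u).1 (Or.inr hu) with rfl | rfl | rfl | rfl
      · exact absurd hu hna
      · exact hirr _
      · exact k3
      · exact k4
    · intro u hu huq
      rcases (hm u).1 (Or.inr hu) with rfl | rfl | rfl | rfl
      · exact absurd hu hna
      · exact absurd rfl huq
      · exact ⟨s, hs, k2⟩
      · exact ⟨r, hr, k2'⟩
  rcases (hm a).1 (Or.inl rfl) with e | e | e | e
  · exact key p q r s h1 h1' h2 h2' h5 h6 h3 h4 hm e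
  · exact key q p r s h1' h1 h2 h2' h3 h4 h5 h6 (fun u => (hm u).trans (by tauto)) e
  · exact key r s p q h2 h2' h1 h1' h4' h6' h3' h5' (fun u => (hm u).trans (by tauto)) e
  · exact key s r p q h2' h2 h1 h1' h3' h5' h4' h6' (fun u => (hm u).trans (by tauto)) e

/-- Let `t ≥ 2` and let `G` be a `K_{2,t}`-free graph.  Then the 4-uniform hypergraph
`H` of induced 2-matchings of `G` contains no copy of `K_{2,t}^{(4)}`. -/
theorem induced2Matching_K2t4_free {V : Type*} [DecidableEq V]
    (t : ℕ) (ht : 2 ≤ t) (G : SimpleGraph V) (hG : ¬ graphHasK2t t G) :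
    ¬ hasK2t4 t (induced2MatchingHypergraph G) := by
  rintro ⟨a, b, x, y, z, hc, hH⟩
  let f : Fin 2 ⊕ (Fin t ⊕ (Fin t ⊕ Fin t)) → V :=
    Sum.elim ![a, b] (Sum.elim x (Sum.elim y z))
  have hf : Function.Injective f := by
    have hi : Finset.image f Finset.univ = ({a, b} ∪ Finset.image x Finset.univ ∪
        Finset.image y Finset.univ ∪ Finset.image z Finset.univ) := by
      ext v
      simp [f, eq_comm, or_assoc]
    rw [← hi] at hc
    have h2 : (Finset.image f Finset.univ).card =
        (Finset.univ : Finset (Fin 2 ⊕ (Fin t ⊕ (Fin t ⊕ Fin t)))).card := by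
      rw [hc]; simp; ring
    have := Finset.card_image_iff.1 h2
    simpa using this
  have hab : a ≠ b := fun h => by
    have := @hf (.inl 0) (.inl 1) h
    simp at this
  have hax : ∀ i, a ≠ x i := fun i h => by
    have := @hf (.inl 0) (.inr (.inl i)) h
    simp at this
  have hay : ∀ i, a ≠ y i := fun i h => by
    have := @hf (.inl 0) (.inr (.inr (.inl i))) h
    simp at this
  have haz : ∀ i, a ≠ z i := fun i h => by
    have := @hf (.inl 0) (.inr (.inr (.inr i))) h
    simp at this
  have hbx : ∀ i, b ≠ x i := fun i h => by
    have := @hf (.inl 1) (.inr (.inl i)) h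
    simp at this
  have hby : ∀ i, b ≠ y i := fun i h => by
    have := @hf (.inl 1) (.inr (.inr (.inl i))) h
    simp at this
  have hbz : ∀ i, b ≠ z i := fun i h => by
    have := @hf (.inl 1) (.inr (.inr (.inr i))) h
    simp at this
  have hw : ∀ i, ∃ w, (w = x i ∨ w = y i ∨ w = z i) ∧ G.Adj a w ∧ G.Adj b w := by
    intro i
    obtain ⟨w, m, aw, iso, -⟩ := aux_edge G a _ _ _ (hax i) (hay i) (haz i) (hH i).1
    obtain ⟨w', -, bw, -, non⟩ := aux_edge G b _ _ _ (hbx i) (hby i) (hbz i) (hH i).2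
    have : w = w' := by
      by_contra hne
      obtain ⟨v, hv, hadj⟩ := non w m hne
      exact iso v hv hadj
    subst this
    exact ⟨w, m, aw, bw⟩
  choose w hm haw hbw using hw
  have hinj : Function.Injective w := by
    have hg : ∀ i, ∃ s : Fin t ⊕ (Fin t ⊕ Fin t), w i = f (.inr s) ∧
        Sum.elim id (Sum.elim id id) s = i := by
      intro i
      rcases hm i with h | h | h
      · exact ⟨.inl i, h, rfl⟩
      · exact ⟨.inr (.inl i), h, rfl⟩
      · exact ⟨.inr (.inr i), h, rfl⟩
    intro i j hij
    obtain ⟨s, hs, rfl⟩ := hg i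
    obtain ⟨s', hs', rfl⟩ := hg j
    have := hf (hs.symm.trans (hij.trans hs'))
    rw [Sum.inr.inj this]
  refine hG ⟨a, b, w, ?_, fun i => ⟨haw i, hbw i⟩⟩
  rw [Finset.card_union_of_disjoint, Finset.card_pair hab, Finset.card_image_of_injective _ hinj]
  · simp; ring
  · rw [Finset.disjoint_left]
    intro v hv hv'
    simp only [Finset.mem_image, Finset.mem_univ, true_and] at hv'
    obtain ⟨i, rfl⟩ := hv'
    simp only [Finset.mem_insert, Finset.mem_singleton] at hv
    rcases hv with h | h
    · exact (haw i).ne h.symm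
    · exact (hbw i).ne h.symm
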